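/- There exist absolute constants c, C, c₀ ∈ (0,1) such that the following holds. Let d ≥ 6, 1 ≤ d_q ≤ d, 0 < ε < C, and d²/2 ≤ ℓ ≤ d² − 1. Let V₁, …, V_ℓ ∈ ℂ^{d×d} be Hermitian, traceless, and orthonormal with respect to the Hilbert–Schmidt inner product, and let 𝒱 = [vec(V₁), …, vec(V_ℓ)] ∈ ℂ^{d²×ℓ}. For z ∈ {−1,+1}^ℓ, set Δ_z = (cε/√(dℓ))·∑_{i=1}^ℓ z_i V_i, let N_z = min{1, 1/(d‖Δ_z‖_∞)}, Δ̄_z = N_z·Δ_z, and ρ_z = I_d/d + Δ̄_z. For each i ∈ [m] let Φ_i : ℂ^{d×d} → ℂ^{d_q×d_q} be a mixedness-preserving quantum channel with Liouville matrix M_{Φ_i}, and set T = (1/m)·∑_{i=1}^m M_{Φ_i}† M_{Φ_i}. If m ≤ c₀ · dℓ/(d_q ε² ‖𝒱† T 𝒱‖₂), then D_{χ²}( E_z[ ⊗_{i=1}^m Φ_i(ρ_z) ] ‖ ⊗_{i=1}^m Φ_i(I_d/d) ) ≤ 1/16, where z is uniform on {−1,+1}^ℓ. -/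

import Mathlib

open Matrix

/-- Frobenius (Schatten-2) norm of a complex matrix. -/
noncomputable def frobNorm {m n : Type*} [Fintype m] [Fintype n] (M : Matrix m n ℂ) : ℝ :=
  Real.sqrt (∑ i, ∑ j, ‖M i j‖ ^ 2)

/-- ℓ₂→ℓ₂ operator norm of a complex matrix. -/
noncomputable def opNorm {n : Type*} [Fintype n] [DecidableEq n] (M : Matrix n n ℂ) : ℝ :=
  ‖Matrix.toEuclideanCLM (𝕜 := ℂ) M‖

/-- The `m`-fold Kronecker product of a family of `d×d` matrices. -/
noncomputable def kronFam (m d : ℕ) (M : Fin m → Matrix (Fin d) (Fin d) ℂ) :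
    Matrix (Fin m → Fin d) (Fin m → Fin d) ℂ :=
  Matrix.of fun x y => ∏ i, M i (x i) (y i)

/-- The Rademacher sign associated to a Boolean. -/
def sgn (b : Bool) : ℂ := if b then 1 else -1

section Auxiliary

open scoped ComplexOrder


/-- The real Rademacher sign associated to a Boolean. -/
def realSgn (b : Bool) : ℝ := if b then 1 else -1

theorem sum_exp_rademacher_le {ι : Type*} [Fintype ι] [DecidableEq ι] (a : ι → ℝ) :
    ∑ z : ι → Bool, Real.exp (∑ j, realSgn (z j) * a j)
      ≤ 2 ^ Fintype.card ι * Real.exp ((∑ j, a j ^ 2) / 2) := by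
  have h : ∑ z : ι → Bool, Real.exp (∑ j, realSgn (z j) * a j)
      = ∏ j, ∑ b : Bool, Real.exp (realSgn b * a j) := by
    rw [Fintype.prod_sum]
    exact Finset.sum_congr rfl fun z _ => Real.exp_sum _ _
  rw [h, Finset.sum_div, Real.exp_sum, ← Finset.card_univ, ← Finset.prod_const,
    ← Finset.prod_mul_distrib]
  refine Finset.prod_le_prod (fun j _ => by positivity) fun j _ => ?_
  have := Real.cosh_le_exp_half_sq (a j)
  rw [Real.cosh_eq] at this
  simp only [Fintype.sum_bool, realSgn]
  norm_num
  linarith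

theorem integral_exp_neg_sq_mul_exp {τ : ℝ} (hτ : 0 ≤ τ) (y : ℝ) :
    ∫ x : ℝ, Real.exp (-x ^ 2) * Real.exp (2 * √τ * x * y) = √Real.pi * Real.exp (τ * y ^ 2) := by
  have h1 : ∀ x : ℝ, Real.exp (-x ^ 2) * Real.exp (2 * √τ * x * y)
      = Real.exp (-1 * (x - √τ * y) ^ 2) * Real.exp (τ * y ^ 2) := fun x => by
    rw [← Real.exp_add, ← Real.exp_add]
    congr 1
    linear_combination y ^ 2 * (Real.sq_sqrt hτ)
  simp_rw [h1]
  rw [MeasureTheory.integral_mul_const,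
    MeasureTheory.integral_sub_right_eq_self (fun x : ℝ => Real.exp (-1 * x ^ 2)) (√τ * y),
    integral_gaussian, div_one]

theorem integrable_exp_neg_sq_mul_exp {τ : ℝ} (hτ : 0 ≤ τ) (y : ℝ) :
    MeasureTheory.Integrable fun x : ℝ => Real.exp (-x ^ 2) * Real.exp (2 * √τ * x * y) := by
  refine MeasureTheory.Integrable.of_integral_ne_zero ?_
  rw [integral_exp_neg_sq_mul_exp hτ]
  positivity

theorem sum_exp_sq_rademacher_le {ι : Type*} [Fintype ι] [DecidableEq ι] (a : ι → ℝ)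
    (ha : ∑ j, a j ^ 2 ≤ 1) {τ : ℝ} (hτ : 0 ≤ τ) (hτ' : 2 * τ < 1) :
    ∑ z : ι → Bool, Real.exp (τ * (∑ j, realSgn (z j) * a j) ^ 2)
      ≤ 2 ^ Fintype.card ι / √(1 - 2 * τ) := by
  have hb : 0 < 1 - 2 * τ := by linarith
  have hpi : 0 < √Real.pi := by positivity
  have key : √Real.pi * ∑ z : ι → Bool, Real.exp (τ * (∑ j, realSgn (z j) * a j) ^ 2)
      ≤ 2 ^ Fintype.card ι * √(Real.pi / (1 - 2 * τ)) := by
    rw [Finset.mul_sum, ← integral_gaussian, ← MeasureTheory.integral_const_mul]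
    simp_rw [← integral_exp_neg_sq_mul_exp hτ]
    rw [← MeasureTheory.integral_finsetSum _ fun z _ => integrable_exp_neg_sq_mul_exp hτ _]
    refine MeasureTheory.integral_mono
      (MeasureTheory.integrable_finsetSum _ fun z _ => integrable_exp_neg_sq_mul_exp hτ _)
      ((integrable_exp_neg_mul_sq hb).const_mul _) fun x => ?_
    have h1 := sum_exp_rademacher_le fun j => 2 * √τ * x * a j
    have h2 : (∑ j, (2 * √τ * x * a j) ^ 2) / 2 ≤ 2 * τ * x ^ 2 := by
      have : ∀ j, (2 * √τ * x * a j) ^ 2 = 4 * τ * x ^ 2 * a j ^ 2 := fun j => by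
        linear_combination 4 * x ^ 2 * a j ^ 2 * Real.sq_sqrt hτ
      simp_rw [this, ← Finset.mul_sum]
      have h0 : 0 ≤ τ * x ^ 2 := by positivity
      nlinarith
    have h3 : Real.exp (-x ^ 2) * Real.exp (2 * τ * x ^ 2) = Real.exp (-(1 - 2 * τ) * x ^ 2) := by
      rw [← Real.exp_add]; congr 1; ring
    calc ∑ z : ι → Bool,
          Real.exp (-x ^ 2) * Real.exp (2 * √τ * x * ∑ j, realSgn (z j) * a j)
        = Real.exp (-x ^ 2) *
            ∑ z : ι → Bool, Real.exp (∑ j, realSgn (z j) * (2 * √τ * x * a j)) := by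
          rw [Finset.mul_sum]
          refine Finset.sum_congr rfl fun z _ => ?_
          congr 2
          rw [Finset.mul_sum]
          exact Finset.sum_congr rfl fun j _ => by ring
      _ ≤ Real.exp (-x ^ 2) * (2 ^ Fintype.card ι * Real.exp (2 * τ * x ^ 2)) := by
          gcongr
          exact h1.trans (by gcongr)
      _ = 2 ^ Fintype.card ι * Real.exp (-(1 - 2 * τ) * x ^ 2) := by
          rw [← h3]; ring
  rw [Real.sqrt_div Real.pi_pos.le, mul_div_assoc', mul_comm (2 ^ _), ← mul_div_assoc'] at key
  exact le_of_mul_le_mul_left key hpi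

theorem sum_exp_sum_sq_rademacher_le {ι κ : Type*} [Fintype ι] [DecidableEq ι] [Fintype κ]
    (g : κ → ι → ℝ) {t : ℝ} (ht : 0 ≤ t) (hS : t * ∑ k, ∑ j, g k j ^ 2 < 1) :
    ∑ z : ι → Bool, Real.exp (t / 2 * ∑ k, (∑ j, realSgn (z j) * g k j) ^ 2)
      ≤ 2 ^ Fintype.card ι / √(1 - t * ∑ k, ∑ j, g k j ^ 2) := by
  set r : κ → ℝ := fun k => ∑ j, g k j ^ 2 with hr
  set S := ∑ k, r k with hS'
  have hr0 : ∀ k, 0 ≤ r k := fun k => Finset.sum_nonneg fun j _ => sq_nonneg _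
  have hS0 : 0 ≤ S := Finset.sum_nonneg fun k _ => hr0 k
  have hg : ∀ k, r k = 0 → ∀ j, g k j = 0 := fun k h j => by
    have := (Finset.sum_eq_zero_iff_of_nonneg (fun j _ => sq_nonneg (g k j))).1 h j
      (Finset.mem_univ j)
    exact pow_eq_zero_iff two_ne_zero |>.1 this
  rcases hS0.eq_or_lt with h | hpos
  · have hz : ∀ k, r k = 0 := fun k =>
      (Finset.sum_eq_zero_iff_of_nonneg (fun k _ => hr0 k)).1 h.symm k (Finset.mem_univ k)
    have : ∀ k j, g k j = 0 := fun k j => hg k (hz k) j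
    simp [this, ← h]
  set u : κ → ι → ℝ := fun k j => g k j / √(r k) with hu
  have hu1 : ∀ k, ∑ j, u k j ^ 2 ≤ 1 := fun k => by
    simp_rw [hu, div_pow, Real.sq_sqrt (hr0 k), ← Finset.sum_div]
    exact div_self_le_one _
  have hgu : ∀ k j, g k j = √(r k) * u k j := fun k j => by
    rcases (hr0 k).eq_or_lt with h | h
    · simp [hg k h.symm j, ← h]
    · have : √(r k) ≠ 0 := (Real.sqrt_pos.2 h).ne'
      simp only [hu]; field_simp
  have hjensen : ∀ z : ι → Bool,
      Real.exp (t / 2 * ∑ k, (∑ j, realSgn (z j) * g k j) ^ 2)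
        ≤ ∑ k, r k / S * Real.exp (t * S / 2 * (∑ j, realSgn (z j) * u k j) ^ 2) := fun z => by
    have := convexOn_exp.map_sum_le (t := Finset.univ) (w := fun k => r k / S)
      (p := fun k => t * S / 2 * (∑ j, realSgn (z j) * u k j) ^ 2)
      (fun k _ => div_nonneg (hr0 k) hS0)
      (by rw [← Finset.sum_div]; exact div_self hpos.ne') (fun k _ => Set.mem_univ _)
    simp only [smul_eq_mul] at this
    refine le_trans (le_of_eq ?_) this
    congr 1
    rw [Finset.mul_sum]
    refine Finset.sum_congr rfl fun k _ => ?_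
    have : ∑ j, realSgn (z j) * g k j = √(r k) * ∑ j, realSgn (z j) * u k j := by
      rw [Finset.mul_sum]
      exact Finset.sum_congr rfl fun j _ => by rw [hgu]; ring
    rw [this, mul_pow, Real.sq_sqrt (hr0 k)]
    field_simp
  calc _ ≤ ∑ z : ι → Bool, ∑ k, r k / S *
            Real.exp (t * S / 2 * (∑ j, realSgn (z j) * u k j) ^ 2) :=
        Finset.sum_le_sum fun z _ => hjensen z
    _ = ∑ k, r k / S * ∑ z : ι → Bool,
            Real.exp (t * S / 2 * (∑ j, realSgn (z j) * u k j) ^ 2) := by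
        rw [Finset.sum_comm]; simp_rw [Finset.mul_sum]
    _ ≤ ∑ k, r k / S * (2 ^ Fintype.card ι / √(1 - 2 * (t * S / 2))) := by
        refine Finset.sum_le_sum fun k _ => mul_le_mul_of_nonneg_left ?_ (div_nonneg (hr0 k) hS0)
        exact sum_exp_sq_rademacher_le _ (hu1 k) (by positivity) (by linarith)
    _ = _ := by
        rw [← Finset.sum_mul, ← Finset.sum_div, div_self hpos.ne', one_mul]
        congr 3; ring

theorem sum_exp_decoupled_chaos_le {ι : Type*} [Fintype ι] [DecidableEq ι]
    (g : ι → ι → ℝ) (hS : ∑ k, ∑ j, g k j ^ 2 < 1) :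
    ∑ z : ι → Bool, ∑ w : ι → Bool,
        Real.exp (∑ k, ∑ j, realSgn (w k) * realSgn (z j) * g k j)
      ≤ 4 ^ Fintype.card ι / √(1 - ∑ k, ∑ j, g k j ^ 2) := by
  have h := sum_exp_sum_sq_rademacher_le g zero_le_one (by rwa [one_mul])
  rw [one_mul] at h
  calc _ ≤ ∑ z : ι → Bool, 2 ^ Fintype.card ι *
          Real.exp (1 / 2 * ∑ k, (∑ j, realSgn (z j) * g k j) ^ 2) := by
        refine Finset.sum_le_sum fun z _ => ?_
        have := sum_exp_rademacher_le fun k => ∑ j, realSgn (z j) * g k j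
        rw [div_eq_inv_mul, ← one_div] at this
        refine le_trans (le_of_eq ?_) this
        simp_rw [Finset.mul_sum, mul_assoc]
    _ ≤ 2 ^ Fintype.card ι * (2 ^ Fintype.card ι / √(1 - ∑ k, ∑ j, g k j ^ 2)) := by
        rw [← Finset.mul_sum]; gcongr
    _ = _ := by
        rw [mul_div_assoc', ← mul_pow]; norm_num

theorem exp_mul_le_of_mem_unit {s x : ℝ} (h0 : 0 ≤ s) (h1 : s ≤ 1) :
    Real.exp (s * x) ≤ 1 + 1 / 32 + 8 * (Real.exp (2 * x) - 2 * Real.exp x + 1) := by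
  have hc := convexOn_exp.2 (Set.mem_univ x) (Set.mem_univ 0) h0 (sub_nonneg.2 h1) (by ring)
  simp only [smul_eq_mul, mul_zero, add_zero, Real.exp_zero, mul_one] at hc
  have h2 : Real.exp (2 * x) = Real.exp x ^ 2 := by rw [← Real.exp_nat_mul]; norm_num
  rw [h2]
  set u := Real.exp x
  have habs : s * (u - 1) ≤ |u - 1| :=
    (mul_le_mul_of_nonneg_left (le_abs_self _) h0).trans
      (mul_le_of_le_one_left (abs_nonneg _) h1)
  have := sq_abs (u - 1)
  nlinarith [sq_nonneg (16 * |u - 1| - 1)]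

theorem sum_exp_damped_chaos_le {ι : Type*} [Fintype ι] [DecidableEq ι]
    (g : ι → ι → ℝ) (hS : ∑ k, ∑ j, g k j ^ 2 ≤ 1 / 2048)
    (s : (ι → Bool) → (ι → Bool) → ℝ) (h0 : ∀ z w, 0 ≤ s z w) (h1 : ∀ z w, s z w ≤ 1) :
    ∑ z : ι → Bool, ∑ w : ι → Bool,
        Real.exp (s z w * ∑ k, ∑ j, realSgn (w k) * realSgn (z j) * g k j)
      ≤ 4 ^ Fintype.card ι * (1 + 1 / 16) := by
  set x : (ι → Bool) → (ι → Bool) → ℝ :=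
    fun z w => ∑ k, ∑ j, realSgn (w k) * realSgn (z j) * g k j with hx
  have h4 : (0 : ℝ) < 4 ^ Fintype.card ι := by positivity
  have hcard : ∑ z : ι → Bool, ∑ w : ι → Bool, (1 : ℝ) = 4 ^ Fintype.card ι := by
    simp [← mul_pow]; norm_num
  have hsum : ∑ z : ι → Bool, ∑ w : ι → Bool, x z w = 0 := by
    refine Finset.sum_eq_zero fun z _ => ?_
    have hneg : ∑ w : ι → Bool, x z w = ∑ w : ι → Bool, -x z w := by
      refine Fintype.sum_equiv (Equiv.piCongrRight fun _ => Equiv.boolNot) _ _ fun w => ?_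
      have : ∀ b, realSgn (!b) = -realSgn b := by rintro (_ | _) <;> simp [realSgn]
      simp [hx, this]
    rw [Finset.sum_neg_distrib] at hneg
    linarith
  have hlow : (4 : ℝ) ^ Fintype.card ι ≤ ∑ z : ι → Bool, ∑ w : ι → Bool, Real.exp (x z w) := by
    calc (4 : ℝ) ^ Fintype.card ι = ∑ z : ι → Bool, ∑ w : ι → Bool, (x z w + 1) := by
          simp_rw [Finset.sum_add_distrib]
          rw [hsum, ← hcard]; simp
      _ ≤ _ := Finset.sum_le_sum fun z _ => Finset.sum_le_sum fun w _ =>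
          Real.add_one_le_exp _
  have hup : ∑ z : ι → Bool, ∑ w : ι → Bool, Real.exp (2 * x z w)
      ≤ 4 ^ Fintype.card ι * (1 + 1 / 511) := by
    have e1 : ∑ k, ∑ j, (2 * g k j) ^ 2 = 4 * ∑ k, ∑ j, g k j ^ 2 := by
      simp_rw [Finset.mul_sum]
      exact Finset.sum_congr rfl fun k _ => Finset.sum_congr rfl fun j _ => by ring
    have h := sum_exp_decoupled_chaos_le (fun k j => 2 * g k j) (by rw [e1]; linarith)
    have e2 : ∀ z w, ∑ k, ∑ j, realSgn (w k) * realSgn (z j) * (2 * g k j) = 2 * x z w := by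
      intro z w
      simp_rw [hx, Finset.mul_sum]
      exact Finset.sum_congr rfl fun k _ => Finset.sum_congr rfl fun j _ => by ring
    simp_rw [e2] at h
    rw [e1] at h
    refine h.trans ?_
    rw [div_eq_mul_inv]
    gcongr
    have : (511 / 512 : ℝ) ≤ √(1 - 4 * ∑ k, ∑ j, g k j ^ 2) := by
      apply Real.le_sqrt_of_sq_le; nlinarith
    calc _ ≤ (511 / 512 : ℝ)⁻¹ := inv_anti₀ (by norm_num) this
      _ ≤ _ := by norm_num
  calc _ ≤ ∑ z : ι → Bool, ∑ w : ι → Bool,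
        (1 + 1 / 32 + 8 * (Real.exp (2 * x z w) - 2 * Real.exp (x z w) + 1)) :=
        Finset.sum_le_sum fun z _ => Finset.sum_le_sum fun w _ =>
          exp_mul_le_of_mem_unit (h0 z w) (h1 z w)
    _ = ∑ z : ι → Bool, ∑ w : ι → Bool,
        ((1 + 1 / 32 + 8) * (1 : ℝ) + 8 * Real.exp (2 * x z w) - 16 * Real.exp (x z w)) :=
        Finset.sum_congr rfl fun z _ => Finset.sum_congr rfl fun w _ => by ring
    _ = (1 + 1 / 32 + 8) * 4 ^ Fintype.card ι
        + 8 * ∑ z : ι → Bool, ∑ w : ι → Bool, Real.exp (2 * x z w)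
        - 16 * ∑ z : ι → Bool, ∑ w : ι → Bool, Real.exp (x z w) := by
        simp_rw [← hcard, Finset.mul_sum, Finset.sum_sub_distrib, Finset.sum_add_distrib]
    _ ≤ _ := by linarith

theorem kronFam_mul {m d : ℕ} (M N : Fin m → Matrix (Fin d) (Fin d) ℂ) :
    kronFam m d M * kronFam m d N = kronFam m d fun i => M i * N i := by
  ext x y
  simp only [kronFam, Matrix.mul_apply, Matrix.of_apply, Fintype.prod_sum,
    ← Finset.prod_mul_distrib]

theorem trace_kronFam {m d : ℕ} (M : Fin m → Matrix (Fin d) (Fin d) ℂ) :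
    (kronFam m d M).trace = ∏ i, (M i).trace := by
  simp only [kronFam, Matrix.trace, Matrix.diag, Matrix.of_apply, Fintype.prod_sum]

theorem kronFam_one (m d : ℕ) : kronFam m d (fun _ => 1) = 1 := by
  ext x y
  simp only [kronFam, Matrix.of_apply, Matrix.one_apply, funext_iff]
  exact Fintype.prod_ite_zero.trans (by simp)

theorem kronFam_inv_smul_one_inv (m : ℕ) {q : ℕ} (hq : q ≠ 0) :
    (kronFam m q fun _ => (q : ℂ)⁻¹ • 1)⁻¹ = kronFam m q fun _ => (q : ℂ) • 1 := by
  refine Matrix.inv_eq_left_inv ?_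
  rw [kronFam_mul, ← kronFam_one]
  congr 1
  funext i
  rw [smul_mul_smul_comm, mul_inv_cancel₀ (Nat.cast_ne_zero.2 hq), one_smul, mul_one]

theorem trace_kronFam_inv_mul_mixture {ι : Type*} [Fintype ι] {m q : ℕ} (hq : q ≠ 0)
    (a : ℂ) (P : Fin m → ι → Matrix (Fin q) (Fin q) ℂ) :
    ((kronFam m q fun _ => (q : ℂ)⁻¹ • 1)⁻¹ * (a • ∑ z, kronFam m q fun i => P i z) *
      (a • ∑ z, kronFam m q fun i => P i z)).trace
      = a ^ 2 * ∑ z, ∑ w, ∏ i, ((q : ℂ) * (P i z * P i w).trace) := by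
  rw [kronFam_inv_smul_one_inv m hq]
  simp only [Matrix.mul_smul, Matrix.smul_mul, Matrix.trace_smul, Finset.mul_sum,
    Finset.sum_mul, Matrix.trace_sum, kronFam_mul, trace_kronFam, smul_eq_mul, Matrix.one_mul,
    sq, mul_assoc]
  rw [Finset.sum_comm]

open scoped MatrixOrder Matrix.Norms.L2Operator in
theorem Matrix.PosSemidef.trace_mul_nonneg {n : Type*} [Fintype n] {A B : Matrix n n ℂ}
    (hA : A.PosSemidef) (hB : B.PosSemidef) : 0 ≤ (A * B).trace := by
  classical
  obtain ⟨C, hC⟩ := CStarAlgebra.nonneg_iff_eq_star_mul_self.1 hB.nonneg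
  rw [hC, Matrix.star_eq_conjTranspose]
  rw [← Matrix.mul_assoc, Matrix.trace_mul_comm, ← Matrix.mul_assoc]
  exact (hA.mul_mul_conjTranspose_same C).trace_nonneg

theorem posSemidef_smul_one_add_of_opNorm_le {n : Type*} [Fintype n] [DecidableEq n]
    {H : Matrix n n ℂ} (hH : H.IsHermitian) {r : ℝ} (hr : opNorm H ≤ r) :
    ((r : ℂ) • (1 : Matrix n n ℂ) + H).PosSemidef := by
  have hR : ((r : ℂ) • (1 : Matrix n n ℂ) + H).IsHermitian := by
    refine Matrix.IsHermitian.add ?_ hH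
    simp [Matrix.IsHermitian, Matrix.conjTranspose_smul]
  refine Matrix.PosSemidef.of_dotProduct_mulVec_nonneg hR fun x => ?_
  have him := hR.im_star_dotProduct_mulVec_self x
  refine Complex.nonneg_iff.2 ⟨?_, him.symm⟩
  set v : EuclideanSpace ℂ n := WithLp.toLp 2 x with hv
  have h1 : star x ⬝ᵥ x = ((‖v‖ ^ 2 : ℝ) : ℂ) := by
    have := inner_self_eq_norm_sq_to_K (𝕜 := ℂ) v
    rw [EuclideanSpace.inner_eq_star_dotProduct] at this
    rw [dotProduct_comm, this]
    push_cast
    rfl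
  have h2 : star x ⬝ᵥ (H *ᵥ x) = inner ℂ v (Matrix.toEuclideanCLM (𝕜 := ℂ) H v) := by
    rw [EuclideanSpace.inner_eq_star_dotProduct, dotProduct_comm]
    rfl
  have h3 : ‖inner ℂ v (Matrix.toEuclideanCLM (𝕜 := ℂ) H v)‖ ≤ r * ‖v‖ ^ 2 := by
    calc _ ≤ ‖v‖ * ‖Matrix.toEuclideanCLM (𝕜 := ℂ) H v‖ := norm_inner_le_norm _ _
      _ ≤ ‖v‖ * (opNorm H * ‖v‖) := by
        gcongr; exact ContinuousLinearMap.le_opNorm _ _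
      _ ≤ ‖v‖ * (r * ‖v‖) := by gcongr
      _ = _ := by ring
  have h4 := (abs_le.1 ((Complex.abs_re_le_norm _).trans h3)).1
  rw [Matrix.add_mulVec, dotProduct_add, Matrix.smul_mulVec, Matrix.one_mulVec, dotProduct_smul,
    h1, h2, smul_eq_mul, ← Complex.ofReal_mul, Complex.add_re, Complex.ofReal_re]
  linarith

theorem sgn_eq_realSgn (b : Bool) : sgn b = (realSgn b : ℂ) := by
  cases b <;> simp [sgn, realSgn]

theorem chiSq_mixture_le {ι : Type*} [Fintype ι] [DecidableEq ι] {m q : ℕ} (hq : q ≠ 0)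
    (b : Fin m → ι → Matrix (Fin q) (Fin q) ℂ) (htr : ∀ i j, (b i j).trace = 0)
    (κ : ℝ) (N : (ι → Bool) → ℝ) (h0 : ∀ z, 0 ≤ N z) (h1 : ∀ z, N z ≤ 1)
    (P : Fin m → (ι → Bool) → Matrix (Fin q) (Fin q) ℂ) (hpsd : ∀ i z, (P i z).PosSemidef)
    (hP : ∀ i z, P i z = (q : ℂ)⁻¹ • 1 + (N z : ℂ) • (κ : ℂ) • ∑ j, sgn (z j) • b i j)
    (hg : ∑ k, ∑ j, (q * κ ^ 2 * ∑ i, (b i k * b i j).trace.re) ^ 2 ≤ 1 / 2048) :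
    (((kronFam m q fun _ => (q : ℂ)⁻¹ • 1)⁻¹ *
      (((2 : ℂ) ^ Fintype.card ι)⁻¹ • ∑ z, kronFam m q fun i => P i z) *
      (((2 : ℂ) ^ Fintype.card ι)⁻¹ • ∑ z, kronFam m q fun i => P i z)).trace).re - 1
      ≤ 1 / 16 := by
  have hqc : (q : ℂ) ≠ 0 := Nat.cast_ne_zero.2 hq
  rw [trace_kronFam_inv_mul_mixture hq]
  set x : (ι → Bool) → (ι → Bool) → Fin m → ℝ := fun w z i =>
    q * κ ^ 2 * ∑ k, ∑ j, realSgn (w k) * realSgn (z j) * (b i k * b i j).trace.re with hx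
  set e : (ι → Bool) → (ι → Bool) → Fin m → ℂ := fun w z i =>
    (q : ℂ) * (P i w * P i z).trace with he
  have htr0 : ∀ i (z : ι → Bool), (∑ j, sgn (z j) • b i j).trace = 0 := fun i z => by
    simp [Matrix.trace_sum, Matrix.trace_smul, htr]
  have hmul : ∀ i (w z : ι → Bool),
      (((∑ j, sgn (w j) • b i j) * ∑ j, sgn (z j) • b i j).trace).re
        = ∑ k, ∑ j, realSgn (w k) * realSgn (z j) * (b i k * b i j).trace.re := fun i w z => by
    simp only [Matrix.sum_mul, Matrix.trace_sum, Matrix.smul_mul, Matrix.mul_smul,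
      Matrix.trace_smul, Complex.re_sum, sgn_eq_realSgn, smul_eq_mul, Complex.re_ofReal_mul,
      Finset.mul_sum]
    rw [Finset.sum_comm]
    exact Finset.sum_congr rfl fun k _ => Finset.sum_congr rfl fun j _ => by ring
  have hre : ∀ w z i, (e w z i).re = 1 + N w * N z * x w z i := fun w z i => by
    have : e w z i = 1 + ((N w * N z * (q * κ ^ 2) : ℝ) : ℂ) *
        ((∑ j, sgn (w j) • b i j) * ∑ j, sgn (z j) • b i j).trace := by
      simp only [he, hP, add_mul, mul_add, Matrix.smul_mul, Matrix.mul_smul, Matrix.one_mul,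
        Matrix.mul_one, Matrix.trace_add, Matrix.trace_smul, htr0, smul_eq_mul, Matrix.trace_one,
        Fintype.card_fin]
      push_cast
      field_simp
      ring
    rw [this, Complex.add_re, Complex.re_ofReal_mul, hmul, Complex.one_re]
    simp only [hx]
    ring
  have hnn : ∀ w z i, 0 ≤ e w z i := fun w z i =>
    mul_nonneg (Nat.cast_nonneg _) ((hpsd i w).trace_mul_nonneg (hpsd i z))
  have hprod : ∀ w z, (∏ i, e w z i).re ≤ Real.exp (N w * N z * ∑ i, x w z i) := fun w z => by
    calc _ ≤ ‖∏ i, e w z i‖ := Complex.re_le_norm _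
      _ = ∏ i, (e w z i).re := by
        rw [norm_prod]
        exact Finset.prod_congr rfl fun i _ => by
          exact congrArg Complex.re (Complex.norm_of_nonneg' (hnn w z i))
      _ ≤ ∏ i, Real.exp (N w * N z * x w z i) := by
        refine Finset.prod_le_prod (fun i _ => (Complex.nonneg_iff.1 (hnn w z i)).1) fun i _ => ?_
        rw [hre, add_comm]
        exact Real.add_one_le_exp _
      _ = _ := by rw [← Real.exp_sum, Finset.mul_sum]
  have hxsum : ∀ w z, ∑ i, x w z i = ∑ k, ∑ j, realSgn (w k) * realSgn (z j) *
      (q * κ ^ 2 * ∑ i, (b i k * b i j).trace.re) := fun w z => by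
    simp only [hx, Finset.mul_sum]
    rw [Finset.sum_comm]
    refine Finset.sum_congr rfl fun k _ => ?_
    rw [Finset.sum_comm]
    exact Finset.sum_congr rfl fun j _ => Finset.sum_congr rfl fun i _ => by ring
  have hsum : ∑ w, ∑ z, (∏ i, e w z i).re ≤ 4 ^ Fintype.card ι * (1 + 1 / 16) := by
    refine le_trans ?_ (sum_exp_damped_chaos_le _ hg (fun z w => N w * N z)
      (fun z w => mul_nonneg (h0 w) (h0 z)) fun z w => mul_le_one₀ (h1 w) (h0 z) (h1 z))
    rw [Finset.sum_comm]
    exact Finset.sum_le_sum fun z _ => Finset.sum_le_sum fun w _ => by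
      rw [← hxsum]; exact hprod w z
  have hcast : (((2 : ℂ) ^ Fintype.card ι)⁻¹) ^ 2 = (((4 : ℝ) ^ Fintype.card ι)⁻¹ : ℝ) := by
    push_cast
    rw [inv_pow, ← pow_mul, mul_comm, pow_mul]
    norm_num
  rw [hcast, Complex.re_ofReal_mul]
  simp only [Complex.re_sum]
  have : (4 ^ Fintype.card ι : ℝ)⁻¹ * ∑ w, ∑ z, (∏ i, e w z i).re ≤ 1 + 1 / 16 := by
    rw [inv_mul_le_iff₀ (by positivity)]
    exact hsum
  linarith

/-- The completely positive map with Kraus operators `A k`, as a linear map. -/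
def krausMap {κ n q : Type*} [Fintype κ] [Fintype n] (A : κ → Matrix q n ℂ) :
    Matrix n n ℂ →ₗ[ℂ] Matrix q q ℂ where
  toFun X := ∑ k, A k * X * (A k)ᴴ
  map_add' X Y := by simp [Matrix.mul_add, Matrix.add_mul, Finset.sum_add_distrib]
  map_smul' c X := by simp [Finset.smul_sum]

section KrausMap

variable {κ n q : Type*} [Fintype κ] [Fintype n] (A : κ → Matrix q n ℂ)

theorem krausMap_apply (X : Matrix n n ℂ) : krausMap A X = ∑ k, A k * X * (A k)ᴴ := rfl

theorem Matrix.IsHermitian.krausMap {X : Matrix n n ℂ} (hX : X.IsHermitian) :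
    (krausMap A X).IsHermitian := by
  rw [krausMap_apply, Matrix.IsHermitian, Matrix.conjTranspose_sum]
  exact Finset.sum_congr rfl fun k _ => Matrix.isHermitian_mul_mul_conjTranspose (A k) hX

theorem Matrix.PosSemidef.krausMap [Fintype q] {X : Matrix n n ℂ} (hX : X.PosSemidef) :
    (krausMap A X).PosSemidef :=
  Matrix.posSemidef_sum _ fun k _ => hX.mul_mul_conjTranspose_same (A k)

theorem trace_krausMap [Fintype q] [DecidableEq n] (hA : ∑ k, (A k)ᴴ * A k = 1)
    (X : Matrix n n ℂ) : (krausMap A X).trace = X.trace := by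
  have h : ∀ k, (A k * X * (A k)ᴴ).trace = ((A k)ᴴ * A k * X).trace := fun k => by
    rw [Matrix.trace_mul_comm, Matrix.mul_assoc]
  simp_rw [krausMap_apply, Matrix.trace_sum, h]
  rw [← Matrix.trace_sum, ← Matrix.sum_mul, hA, Matrix.one_mul]

end KrausMap

/-- The Gram matrix of the images of `V` under a map with Liouville matrix `M`. -/
theorem gram_liouville_apply {ι n q : Type*} [Fintype n] [Fintype q]
    {Φ : Matrix n n ℂ → Matrix q q ℂ} {M : Matrix (q × q) (n × n) ℂ}
    (hM : ∀ X : Matrix n n ℂ,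
      (fun p : q × q => Φ X p.1 p.2) = M.mulVec fun p : n × n => X p.1 p.2)
    (V : ι → Matrix n n ℂ) (j k : ι) :
    ((Matrix.of fun (p : n × n) i => V i p.1 p.2)ᴴ * (Mᴴ * M) *
      Matrix.of fun (p : n × n) i => V i p.1 p.2) j k = ((Φ (V j))ᴴ * Φ (V k)).trace := by
  have h : ∀ p i, (M * Matrix.of fun (p : n × n) i => V i p.1 p.2) p i = Φ (V i) p.1 p.2 :=
    fun p i => (congrFun (hM (V i)) p).symm
  rw [← Matrix.mul_assoc, ← Matrix.conjTranspose_mul, Matrix.mul_assoc, Matrix.mul_apply]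
  simp only [Matrix.conjTranspose_apply, h, Matrix.trace, Matrix.diag, Matrix.mul_apply]
  rw [Fintype.sum_prod_type_right]

theorem opNorm_smul {n : Type*} [Fintype n] [DecidableEq n] (c : ℂ) (H : Matrix n n ℂ) :
    opNorm (c • H) = ‖c‖ * opNorm H := by
  rw [opNorm, map_smul, norm_smul, opNorm]

theorem frobNorm_sq {m n : Type*} [Fintype m] [Fintype n] (M : Matrix m n ℂ) :
    frobNorm M ^ 2 = ∑ i, ∑ j, ‖M i j‖ ^ 2 :=
  Real.sq_sqrt (by positivity)

end Auxiliary

open scoped ComplexOrder in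
/-- Key lemma for the lower bounds: there are absolute constants `c, C, c₀ ∈ (0,1)` so that
for the hard ensemble `ρ_z = I/d + Δ̄_z` built from a Hilbert–Schmidt-orthonormal family of
Hermitian traceless `V₁,…,V_ℓ`, and any mixedness-preserving channels `Φ₁,…,Φ_m` with
Liouville matrices `M_{Φ_i}`, if `m ≤ c₀·dℓ/(d_q ε² ‖𝒱† T 𝒱‖₂)` with
`T = (1/m)∑ M_{Φ_i}† M_{Φ_i}`, then
`D_{χ²}(E_z[⊗_i Φ_i(ρ_z)] ‖ ⊗_i Φ_i(I/d)) ≤ 1/16`. -/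
theorem stmt12 :
    ∃ c C c₀ : ℝ, 0 < c ∧ c < 1 ∧ 0 < C ∧ C < 1 ∧ 0 < c₀ ∧ c₀ < 1 ∧
    ∀ (d dq m l K : ℕ) (ε : ℝ),
      6 ≤ d → 1 ≤ dq → dq ≤ d → 0 < ε → ε < C →
      d ^ 2 ≤ 2 * l → l + 1 ≤ d ^ 2 → 1 ≤ m →
    ∀ (V : Fin l → Matrix (Fin d) (Fin d) ℂ),
      (∀ i, (V i).IsHermitian) → (∀ i, (V i).trace = 0) →
      (∀ i j, ((V i)ᴴ * V j).trace = if i = j then 1 else 0) →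
    ∀ (A : Fin m → Fin K → Matrix (Fin dq) (Fin d) ℂ),
      (∀ i, ∑ k, (A i k)ᴴ * A i k = 1) →
      (∀ i, ∑ k, A i k * (A i k)ᴴ = ((d : ℂ) / (dq : ℂ)) • 1) →
    let Φ : Fin m → Matrix (Fin d) (Fin d) ℂ → Matrix (Fin dq) (Fin dq) ℂ :=
      fun i X => ∑ k, A i k * X * (A i k)ᴴ
    ∀ (M : Fin m → Matrix (Fin dq × Fin dq) (Fin d × Fin d) ℂ),
      (∀ i (X : Matrix (Fin d) (Fin d) ℂ),
        (fun p : Fin dq × Fin dq => Φ i X p.1 p.2)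
          = (M i).mulVec (fun p : Fin d × Fin d => X p.1 p.2)) →
    let 𝒱 : Matrix (Fin d × Fin d) (Fin l) ℂ :=
      Matrix.of fun p i => V i p.1 p.2
    let T : Matrix (Fin d × Fin d) (Fin d × Fin d) ℂ :=
      ((m : ℂ))⁻¹ • ∑ i, (M i)ᴴ * M i
    let Δ : (Fin l → Bool) → Matrix (Fin d) (Fin d) ℂ :=
      fun z => (((c * ε / Real.sqrt ((d : ℝ) * l) : ℝ) : ℂ)) • ∑ j, sgn (z j) • V j
    let ρ : (Fin l → Bool) → Matrix (Fin d) (Fin d) ℂ :=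
      fun z => ((d : ℂ))⁻¹ • 1 +
        (((min 1 (1 / ((d : ℝ) * opNorm (Δ z))) : ℝ) : ℂ)) • Δ z
    let ρbar : Matrix (Fin m → Fin dq) (Fin m → Fin dq) ℂ :=
      (((2 : ℂ)) ^ l)⁻¹ • ∑ z : Fin l → Bool, kronFam m dq (fun i => Φ i (ρ z))
    let σm : Matrix (Fin m → Fin dq) (Fin m → Fin dq) ℂ :=
      kronFam m dq (fun i => Φ i (((d : ℂ))⁻¹ • 1))
    (m : ℝ) ≤ c₀ * ((d : ℝ) * l) / ((dq : ℝ) * ε ^ 2 * frobNorm (𝒱ᴴ * T * 𝒱)) →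
    ((σm⁻¹ * ρbar * ρbar).trace).re - 1 ≤ 1 / 16 := by
  refine ⟨1 / 2, 1 / 2, 1 / 16, by norm_num, by norm_num, by norm_num, by norm_num, by norm_num,
    by norm_num, ?_⟩
  intro d dq m l K ε hd hdq _ hε _ hl _ hm V hVh hVt _ A hA1 hA2 Φ M hM 𝒱 T Δ ρ ρbar σm hbound
  have hdpos : (0 : ℝ) < d := by exact_mod_cast (by omega : 0 < d)
  have hqpos : (0 : ℝ) < dq := by exact_mod_cast hdq
  have hmpos : (0 : ℝ) < m := by exact_mod_cast hm
  have hlpos : (0 : ℝ) < l := by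
    have : 0 < d ^ 2 := by positivity
    exact_mod_cast (by omega : 0 < l)
  have hdc : (d : ℂ) ≠ 0 := by exact_mod_cast hdpos.ne'
  have hqc : (dq : ℂ) ≠ 0 := by exact_mod_cast hqpos.ne'
  set κ : ℝ := 1 / 2 * ε / Real.sqrt ((d : ℝ) * l) with hκ
  set N : (Fin l → Bool) → ℝ := fun z => min 1 (1 / ((d : ℝ) * opNorm (Δ z))) with hN
  have hop : ∀ z, 0 ≤ opNorm (Δ z) := fun z => norm_nonneg _
  have hN0 : ∀ z, 0 ≤ N z := fun z =>
    le_min zero_le_one (one_div_nonneg.2 (mul_nonneg hdpos.le (hop z)))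
  have hN1 : ∀ z, N z ≤ 1 := fun z => min_le_left _ _
  have hΦ1 : ∀ i, krausMap (A i) ((d : ℂ)⁻¹ • 1) = (dq : ℂ)⁻¹ • 1 := fun i => by
    rw [map_smul, krausMap_apply]
    simp only [Matrix.mul_one]
    rw [hA2, smul_smul]
    congr 1
    field_simp
  have hΔh : ∀ z, (Δ z).IsHermitian := fun z => by
    simp only [Δ, Matrix.IsHermitian, Matrix.conjTranspose_smul, Matrix.conjTranspose_sum,
      sgn_eq_realSgn, RCLike.star_def, Complex.conj_ofReal, fun i => (hVh i).eq]
  have hρ : ∀ z, (ρ z).PosSemidef := fun z => by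
    have hH : ((N z : ℂ) • Δ z).IsHermitian := by
      simp only [Matrix.IsHermitian, Matrix.conjTranspose_smul, RCLike.star_def,
        Complex.conj_ofReal, (hΔh z).eq]
    have hle : opNorm ((N z : ℂ) • Δ z) ≤ (d : ℝ)⁻¹ := by
      rw [opNorm_smul, Complex.norm_of_nonneg (hN0 z)]
      rcases (hop z).eq_or_lt with h | h
      · rw [← h, mul_zero]; positivity
      · calc N z * opNorm (Δ z) ≤ 1 / ((d : ℝ) * opNorm (Δ z)) * opNorm (Δ z) := by
              gcongr; exact min_le_right _ _
          _ = (d : ℝ)⁻¹ := by field_simp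
    have := posSemidef_smul_one_add_of_opNorm_le hH hle
    rwa [Complex.ofReal_inv, Complex.ofReal_natCast] at this
  have hP : ∀ i z, krausMap (A i) (ρ z) = (dq : ℂ)⁻¹ • 1 +
      (N z : ℂ) • (κ : ℂ) • ∑ j, sgn (z j) • krausMap (A i) (V j) := fun i z => by
    simp only [ρ, Δ, map_add, hΦ1, map_smul, map_sum]
    rfl
  have hG : ∀ k j, (𝒱ᴴ * T * 𝒱) k j
      = (m : ℂ)⁻¹ * ∑ i, (krausMap (A i) (V k) * krausMap (A i) (V j)).trace := fun k j => by
    simp only [T, Matrix.mul_smul, Matrix.smul_mul, Matrix.mul_sum, Matrix.sum_mul,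
      Matrix.smul_apply, Matrix.sum_apply, smul_eq_mul]
    congr 1
    refine Finset.sum_congr rfl fun i _ => ?_
    have := gram_liouville_apply (hM i) V k j
    refine this.trans ?_
    change ((krausMap (A i) (V k))ᴴ * krausMap (A i) (V j)).trace = _
    rw [((hVh k).krausMap (A i)).eq]
  set F := frobNorm (𝒱ᴴ * T * 𝒱) with hF
  have hF0 : 0 < F := by
    have hF' : 0 ≤ F := Real.sqrt_nonneg _
    refine hF'.lt_of_ne' fun h => ?_
    rw [h, mul_zero, div_zero] at hbound
    linarith
  have hκ2 : κ ^ 2 = ε ^ 2 / (4 * (d * l)) := by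
    rw [hκ, div_pow, Real.sq_sqrt (by positivity)]
    field_simp
    ring
  have hsmall : dq * κ ^ 2 * m * F ≤ 1 / 64 := by
    rw [le_div_iff₀ (by positivity)] at hbound
    rw [hκ2, mul_div_assoc', div_mul_eq_mul_div, div_mul_eq_mul_div, div_le_iff₀ (by positivity)]
    linarith
  have hg : ∑ k, ∑ j, (dq * κ ^ 2 *
      ∑ i, (krausMap (A i) (V k) * krausMap (A i) (V j)).trace.re) ^ 2 ≤ 1 / 2048 := by
    have hentry : ∀ k j, (dq * κ ^ 2 *
        ∑ i, (krausMap (A i) (V k) * krausMap (A i) (V j)).trace.re) ^ 2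
          ≤ (dq * κ ^ 2 * m) ^ 2 * ‖(𝒱ᴴ * T * 𝒱) k j‖ ^ 2 := fun k j => by
      have hre : ∑ i, (krausMap (A i) (V k) * krausMap (A i) (V j)).trace.re
          = m * ((𝒱ᴴ * T * 𝒱) k j).re := by
        rw [hG, ← Complex.ofReal_natCast, ← Complex.ofReal_inv, Complex.re_ofReal_mul,
          Complex.re_sum, mul_inv_cancel_left₀ hmpos.ne']
      rw [hre, ← mul_assoc, mul_pow]
      gcongr ?_ * ?_
      exact sq_le_sq.2 (by rw [abs_norm]; exact Complex.abs_re_le_norm _)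
    calc _ ≤ ∑ k, ∑ j, (dq * κ ^ 2 * m) ^ 2 * ‖(𝒱ᴴ * T * 𝒱) k j‖ ^ 2 :=
          Finset.sum_le_sum fun k _ => Finset.sum_le_sum fun j _ => hentry k j
      _ = (dq * κ ^ 2 * m * F) ^ 2 := by
          rw [mul_pow _ F, hF, frobNorm_sq]
          simp_rw [Finset.mul_sum]
      _ ≤ (1 / 64) ^ 2 := by gcongr
      _ ≤ _ := by norm_num
  have hσ : σm = kronFam m dq fun _ => (dq : ℂ)⁻¹ • 1 := by
    simp only [σm]
    congr 1
    funext i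
    exact hΦ1 i
  have := chiSq_mixture_le (Nat.one_le_iff_ne_zero.1 hdq)
    (fun i j => krausMap (A i) (V j)) (fun i j => by rw [trace_krausMap _ (hA1 i), hVt])
    κ N hN0 hN1 (fun i z => krausMap (A i) (ρ z)) (fun i z => (hρ z).krausMap (A i)) hP hg
  rw [Fintype.card_fin, ← hσ] at this
  exact this
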